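/- Let d ≥ 1, n := d(d+1)/2, τ* := n+1, let ḡ be an admissible metric, i.e. a symmetric positive-definite bilinear form on ℝ^d for which there is γ₀ > 0 with |Σ_{i≤j} ḡ_{ij} ℓ_{ij}| ≥ γ₀·(Σ_{i≤j}|ℓ_{ij}|)^{−τ*} for every nonzero integer vector ℓ ∈ ℤ^n. Let 0 < β₁ < β₂, m > 0, and for β ∈ ℬ := (β₁,β₂) define the beam frequencies ω_j(β) := √(β⁴ |j|_ḡ⁴ + m), j ∈ ℤ^d. Then there exists a set ℬ^{res} ⊂ ℬ of Lebesgue measure zero such that for every β ∈ ℬ ∖ ℬ^{res} the frequencies ω_j = ω_j(β) satisfy: (F.2) for every r ≥ 3 there are γ_r > 0 and τ_r such that for all N ≥ 1, all j₁,…,j_r ∈ ℤ^d with |j_l| ≤ N and all signs σ_l ∈ {−1,+1}, if Σ_l σ_l ω_{j_l} ≠ 0 then |Σ_l σ_l ω_{j_l}| ≥ γ_r N^{−τ_r}; (NR.1) the equivalence classes [i] := {j ∈ ℤ^d : ω_j = ω_i} are dyadic: there is C > 0 with C·inf_{j∈[i]}|j| ≥ sup_{j∈[i]}|j| for all i; and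 (NR.2) for every l ∈ ℕ, every j₁,…,j_l ∈ ℤ^d with pairwise distinct classes [j_i] ≠ [j_k] for i ≠ k, and every choice of signs, ω_{j₁} ± ω_{j₂} ± ⋯ ± ω_{j_l} ≠ 0. -/

import Mathlib

open scoped BigOperators

namespace AG

abbrev Zd (d : ℕ) := Fin d → ℤ

noncomputable def enorm {d : ℕ} (j : Zd d) : ℝ := Real.sqrt (∑ i, ((j i : ℝ))^2)

/-- `|j|_g² = g(j,j)` for a quadratic form with coefficients `g`. -/
noncomputable def qform (d : ℕ) (g : Fin d → Fin d → ℝ) (j : Zd d) : ℝ :=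
  ∑ i, ∑ k, g i k * (j i : ℝ) * (j k : ℝ)

/-- `τ* = d(d+1)/2 + 1`. -/
def tauStar (d : ℕ) : ℕ := d * (d + 1) / 2 + 1

/-- `g` is an admissible (γ-diophantine) metric:
`|Σ_{i≤j} g_{ij} ℓ_{ij}| ≥ γ (Σ_{i≤j}|ℓ_{ij}|)^{−τ*}` for all nonzero `ℓ ∈ ℤ^{d(d+1)/2}`. -/
def Diophantine (d : ℕ) (g : Fin d → Fin d → ℝ) (γ : ℝ) : Prop :=
  ∀ ℓ : Fin d → Fin d → ℤ, (∃ i j, i ≤ j ∧ ℓ i j ≠ 0) →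
    γ / (∑ i, ∑ j, if i ≤ j then (|ℓ i j| : ℝ) else 0) ^ tauStar d ≤
      |∑ i, ∑ j, if i ≤ j then g i j * (ℓ i j : ℝ) else 0|

/-- The beam frequencies `ω_j(β) = √(β⁴ |j|_ḡ⁴ + m)`. -/
noncomputable def beamOmega (d : ℕ) (gbar : Fin d → Fin d → ℝ) (m β : ℝ)
    (j : Zd d) : ℝ :=
  Real.sqrt (β ^ 4 * (qform d gbar j) ^ 2 + m)

lemma rpow_le_T {T y : ℝ} (p : ℝ) (hT : 2 ≤ T) (h1 : T⁻¹ ≤ y) (h2 : y ≤ T) : y ^ p ≤ T ^ |p| := by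
  have hT0 : 0 < T⁻¹ := by positivity
  rcases le_total 0 p with h | h
  · rw [abs_of_nonneg h]
    exact Real.rpow_le_rpow (by linarith) h2 h
  · rw [abs_of_nonpos h]
    calc y ^ p ≤ (T⁻¹) ^ p := Real.rpow_le_rpow_of_nonpos hT0 h1 h
      _ = T ^ (-p) := by rw [Real.inv_rpow (by linarith), Real.rpow_neg (by linarith)]

lemma hasDeriv_term (m u v p x : ℝ) (hu : 0 < x * u + m) (hv : 0 < x * v + m) :
    HasDerivAt (fun x => (x * u + m) ^ p * (x * v + m) ^ (-p))
      (p * m * (x * v + m) ^ (-p - 1) * ((u - v) * (x * u + m) ^ (p - 1))) x := by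
  have h1 : HasDerivAt (fun x : ℝ => x * u + m) u x := by
    simpa using ((hasDerivAt_id x).mul_const u).add_const m
  have h2 : HasDerivAt (fun x : ℝ => x * v + m) v x := by
    simpa using ((hasDerivAt_id x).mul_const v).add_const m
  have h3 := (h1.rpow_const (p := p) (Or.inl hu.ne')).mul
    (h2.rpow_const (p := -p) (Or.inl hv.ne'))
  refine h3.congr_deriv ?_
  have e1 : (x * u + m) ^ p = (x * u + m) ^ (p - 1) * (x * u + m) := by
    rw [← Real.rpow_add_one hu.ne']; congr 1; ring
  have e2 : (x * v + m) ^ (-p) = (x * v + m) ^ (-p - 1) * (x * v + m) := by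
    rw [← Real.rpow_add_one hv.ne']; congr 1; ring
  rw [e1, e2]; ring

lemma base_bds {T m X x u : ℝ} (hmT : T⁻¹ ≤ m) (hx0 : 0 ≤ x) (hxX : x ≤ X) (hu : 0 ≤ u)
    (hT : X * u + m ≤ T) : T⁻¹ ≤ x * u + m ∧ x * u + m ≤ T := by
  have h1 : 0 ≤ x * u := by positivity
  have h2 : x * u ≤ X * u := by gcongr
  constructor <;> linarith

lemma single {T y p c κ ε : ℝ} (hT : 2 ≤ T) (h1 : T⁻¹ ≤ y) (h2 : y ≤ T) (hκ : κ ≤ |c|)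
    (hf : |c * y ^ p| ≤ ε) : κ ≤ ε * T ^ |p| := by
  have hy : 0 < y := lt_of_lt_of_le (by positivity) h1
  have h3 := rpow_le_T (-p) hT h1 h2
  rw [abs_neg] at h3
  have h4 : |c| = |c * y ^ p| * y ^ (-p) := by
    rw [abs_mul, abs_of_pos (Real.rpow_pos_of_pos hy p), mul_assoc, ← Real.rpow_add hy]
    simp
  calc κ ≤ |c| := hκ
    _ = |c * y ^ p| * y ^ (-p) := h4
    _ ≤ ε * T ^ |p| := by
      have : 0 < y ^ (-p) := Real.rpow_pos_of_pos hy _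
      exact mul_le_mul hf h3 this.le (le_trans (abs_nonneg _) hf)

/-- one elimination step between two separated points -/
lemma step {T m X ε p a b v : ℝ} {s : Finset ℝ} {c : ℝ → ℝ} (hT : 2 ≤ T) (hm : 0 < m)
    (hp : 1 / 2 ≤ |p|) (hmT : T⁻¹ ≤ m) (hv : v ∈ s)
    (hu : ∀ u ∈ s, 0 ≤ u ∧ X * u + m ≤ T) (ha : 0 ≤ a) (hb : b ≤ X) (hab : a + T⁻¹ ≤ b)
    (hfa : |∑ u ∈ s, c u * (a * u + m) ^ p| ≤ ε) (hfb : |∑ u ∈ s, c u * (b * u + m) ^ p| ≤ ε) :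
    ∃ ξ ∈ Set.Ioo a b, |∑ u ∈ s.erase v, c u * (u - v) * (ξ * u + m) ^ (p - 1)| ≤
      ε * 4 * T ^ (|p| + |p + 1| + 2) := by
  have hT0 : 0 < T := by linarith
  have hTi : 0 < T⁻¹ := by positivity
  have hε : 0 ≤ ε := le_trans (abs_nonneg _) hfa
  have hlt : a < b := by linarith
  have bd : ∀ x ∈ Set.Icc a b, ∀ u ∈ s, T⁻¹ ≤ x * u + m ∧ x * u + m ≤ T := fun x hx u hus =>
    base_bds hmT (ha.trans hx.1) (hx.2.trans hb) (hu u hus).1 (hu u hus).2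
  have pos : ∀ x ∈ Set.Icc a b, ∀ u ∈ s, 0 < x * u + m := fun x hx u hus =>
    lt_of_lt_of_le hTi (bd x hx u hus).1
  set G : ℝ → ℝ := fun x => ∑ u ∈ s, c u * ((x * u + m) ^ p * (x * v + m) ^ (-p)) with hG
  set G' : ℝ → ℝ := fun x => ∑ u ∈ s, c u *
    (p * m * (x * v + m) ^ (-p - 1) * ((u - v) * (x * u + m) ^ (p - 1))) with hG'
  have hd : ∀ x ∈ Set.Icc a b, HasDerivAt G (G' x) x := by
    intro x hx
    apply HasDerivAt.fun_sum
    intro u hus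
    exact (hasDeriv_term m u v p x (pos x hx u hus) (pos x hx v hv)).const_mul (c u)
  obtain ⟨ξ, hξ, hs⟩ := exists_hasDerivAt_eq_slope G G' hlt
    (fun x hx => (hd x hx).continuousAt.continuousWithinAt)
    (fun x hx => hd x (Set.Ioo_subset_Icc_self hx))
  refine ⟨ξ, hξ, ?_⟩
  have hξ' := Set.Ioo_subset_Icc_self hξ
  have Gf : ∀ x, G x = (∑ u ∈ s, c u * (x * u + m) ^ p) * (x * v + m) ^ (-p) := by
    intro x; simp only [hG, Finset.sum_mul]
    refine Finset.sum_congr rfl fun u _ => by ring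
  have Gb : ∀ x ∈ Set.Icc a b, |∑ u ∈ s, c u * (x * u + m) ^ p| ≤ ε → |G x| ≤ ε * T ^ |p| := by
    intro x hx hfx
    rw [Gf, abs_mul, abs_of_pos (Real.rpow_pos_of_pos (pos x hx v hv) _)]
    have h3 := rpow_le_T (-p) hT (bd x hx v hv).1 (bd x hx v hv).2
    rw [abs_neg] at h3
    exact mul_le_mul hfx h3 (Real.rpow_pos_of_pos (pos x hx v hv) _).le hε
  have hGa := Gb a ⟨le_rfl, hlt.le⟩ hfa
  have hGb := Gb b ⟨hlt.le, le_rfl⟩ hfb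
  have hG'b : |G' ξ| ≤ 2 * ε * T ^ |p| * T := by
    rw [hs, abs_div, abs_of_pos (by linarith : 0 < b - a), div_le_iff₀ (by linarith)]
    have h1 : |G b - G a| ≤ 2 * ε * T ^ |p| := by
      calc _ ≤ |G b| + |G a| := abs_sub _ _
        _ ≤ _ := by linarith
    have h2 : 1 ≤ T * (b - a) := by
      have : T * T⁻¹ ≤ T * (b - a) := by gcongr; linarith
      rwa [mul_inv_cancel₀ hT0.ne'] at this
    have h3 : 0 ≤ 2 * ε * T ^ |p| := by positivity
    nlinarith
  set h : ℝ := ∑ u ∈ s.erase v, c u * (u - v) * (ξ * u + m) ^ (p - 1) with hh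
  have hGh : G' ξ = p * m * (ξ * v + m) ^ (-p - 1) * h := by
    simp only [hG', hh, Finset.mul_sum]
    rw [← Finset.add_sum_erase _ _ hv]
    simp only [sub_self, zero_mul, mul_zero, zero_add]
    refine Finset.sum_congr rfl fun u _ => by ring
  have py := pos ξ hξ' v hv
  have hinv : (ξ * v + m) ^ (-p - 1) * (ξ * v + m) ^ (p + 1) = 1 := by
    rw [← Real.rpow_add py]; ring_nf; exact Real.rpow_zero _
  have hp0 : 0 < |p| := by linarith
  have h5 := rpow_le_T (p + 1) hT (bd ξ hξ' v hv).1 (bd ξ hξ' v hv).2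
  have h6 : |p| * m * |h| = |G' ξ| * (ξ * v + m) ^ (p + 1) := by
    rw [hGh, abs_mul, abs_mul, abs_mul, abs_of_pos hm, abs_of_pos (Real.rpow_pos_of_pos py _)]
    linear_combination (-(|p| * m * |h|)) * hinv
  have h7 : |p| * m * |h| ≤ 2 * ε * T ^ |p| * T * T ^ |p + 1| := by
    rw [h6]
    exact mul_le_mul hG'b h5 (Real.rpow_pos_of_pos py _).le (by positivity)
  have h8 : 1 ≤ 2 * T * (|p| * m) := by
    have : 1 / 2 * T⁻¹ ≤ |p| * m := mul_le_mul hp hmT hTi.le hp0.le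
    have h9 : T * (1 / 2 * T⁻¹) ≤ T * (|p| * m) := by gcongr
    have : T * (1 / 2 * T⁻¹) = 1 / 2 := by field_simp
    linarith
  have e : T ^ (|p| + |p + 1| + 2) = T ^ |p| * T ^ |p + 1| * T ^ 2 := by
    rw [Real.rpow_add hT0, Real.rpow_add hT0]; norm_num
  calc |h| = 1 * |h| := by ring
    _ ≤ 2 * T * (|p| * m) * |h| := by gcongr
    _ = 2 * T * (|p| * m * |h|) := by ring
    _ ≤ 2 * T * (2 * ε * T ^ |p| * T * T ^ |p + 1|) := by gcongr
    _ = _ := by rw [e]; ring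

lemma key (k : ℕ) : ∀ (p : ℝ), (∀ n : ℕ, 1 / 2 ≤ |p - n|) → ∃ E : ℝ, 0 ≤ E ∧
    ∀ (T m X κ ε : ℝ) (s : Finset ℝ) (c : ℝ → ℝ) (x : ℕ → ℝ), 2 ≤ T → 0 < m → T⁻¹ ≤ m →
      s.Nonempty → s.card ≤ k + 1 → (∀ u ∈ s, 0 ≤ u ∧ X * u + m ≤ T) →
      (∀ u ∈ s, ∀ v ∈ s, u ≠ v → T⁻¹ ≤ |u - v|) → 0 ≤ κ → (∀ u ∈ s, κ ≤ |c u|) →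
      (∀ i < 2 ^ k, 0 ≤ x i ∧ x i ≤ X) → (∀ i, i + 1 < 2 ^ k → x i + T⁻¹ ≤ x (i + 1)) →
      (∀ i < 2 ^ k, |∑ u ∈ s, c u * (x i * u + m) ^ p| ≤ ε) → κ ≤ ε * T ^ E := by
  induction k with
  | zero =>
    intro p hp
    refine ⟨|p|, abs_nonneg _, ?_⟩
    intro T m X κ ε s c x hT hm hmT hs hcard hu hsep hκ hc hx hgap hf
    obtain ⟨v, rfl⟩ := Finset.card_eq_one.mp (le_antisymm hcard hs.card_pos)
    have h0 := hx 0 (by norm_num)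
    have hv := hu v (by simp)
    have hb := base_bds hmT h0.1 h0.2 hv.1 hv.2
    exact single hT hb.1 hb.2 (hc v (by simp)) (by simpa using hf 0 (by norm_num))
  | succ k ih =>
    intro p hp
    obtain ⟨E, hE, H⟩ := ih (p - 1) (by
      intro n; have := hp (n + 1); push_cast at this; rwa [sub_sub, add_comm (1:ℝ)])
    refine ⟨E + |p| + |p + 1| + 5, by positivity, ?_⟩
    intro T m X κ ε s c x hT hm hmT hs hcard hu hsep hκ hc hx hgap hf
    have hT0 : 0 < T := by linarith
    have hε : 0 ≤ ε := le_trans (abs_nonneg _) (hf 0 (by positivity))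
    obtain ⟨v, hv⟩ := hs
    rcases (s.erase v).eq_empty_or_nonempty with he | hne
    · have hsv : s = {v} := by
        rw [← Finset.insert_erase hv, he]; rfl
      subst hsv
      have h0 := hx 0 (by positivity)
      have hv' := hu v hv
      have hb := base_bds hmT h0.1 h0.2 hv'.1 hv'.2
      refine (single hT hb.1 hb.2 (hc v (by simp)) (by simpa using hf 0 (by positivity))).trans ?_
      gcongr
      · linarith
      · linarith [abs_nonneg (p + 1)]
    · have hp0 : 1 / 2 ≤ |p| := by simpa using hp 0
      have hstep : ∀ i, ∃ ξ : ℝ, i < 2 ^ k → (ξ ∈ Set.Ioo (x (2 * i)) (x (2 * i + 1)) ∧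
          |∑ u ∈ s.erase v, c u * (u - v) * (ξ * u + m) ^ (p - 1)| ≤
            ε * 4 * T ^ (|p| + |p + 1| + 2)) := by
        intro i
        by_cases hi : i < 2 ^ k
        · have i1 : 2 * i < 2 ^ (k + 1) := by rw [pow_succ]; omega
          have i2 : 2 * i + 1 < 2 ^ (k + 1) := by rw [pow_succ]; omega
          obtain ⟨ξ, h1, h2⟩ := step hT hm hp0 hmT hv hu (hx _ i1).1 (hx _ i2).2 (hgap _ i2)
            (hf _ i1) (hf _ i2)
          exact ⟨ξ, fun _ => ⟨h1, h2⟩⟩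
        · exact ⟨0, fun h => absurd h hi⟩
      choose y hy using hstep
      have hfin := H T m X (κ * T⁻¹) (ε * 4 * T ^ (|p| + |p + 1| + 2)) (s.erase v)
        (fun u => c u * (u - v)) y hT hm hmT hne
        (by rw [Finset.card_erase_of_mem hv]; omega)
        (fun u hus => hu u (Finset.mem_of_mem_erase hus))
        (fun u hus w hws => hsep u (Finset.mem_of_mem_erase hus) w (Finset.mem_of_mem_erase hws))
        (by positivity)
        (by
          intro u hus
          rw [abs_mul]
          exact mul_le_mul (hc u (Finset.mem_of_mem_erase hus))
            (hsep u (Finset.mem_of_mem_erase hus) v hv (Finset.ne_of_mem_erase hus))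
            (by positivity) (abs_nonneg _))
        (by
          intro i hi
          have i1 : 2 * i < 2 ^ (k + 1) := by rw [pow_succ]; omega
          have i2 : 2 * i + 1 < 2 ^ (k + 1) := by rw [pow_succ]; omega
          have := (hy i hi).1
          exact ⟨(hx _ i1).1.trans this.1.le, this.2.le.trans (hx _ i2).2⟩)
        (by
          intro i hi
          have i2 : 2 * i + 1 + 1 < 2 ^ (k + 1) := by rw [pow_succ]; omega
          have h1 := (hy i (by omega)).1.2
          have h2 := (hy (i + 1) hi).1.1
          have h3 := hgap (2 * i + 1) i2
          have e : 2 * (i + 1) = 2 * i + 1 + 1 := by ring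
          rw [e] at h2
          linarith)
        (fun i hi => (hy i hi).2)
      have e : T ^ (E + |p| + |p + 1| + 5) = T ^ (|p| + |p + 1| + 2) * T ^ E * T ^ 3 := by
        rw [← Real.rpow_add hT0, ← Real.rpow_natCast T 3, ← Real.rpow_add hT0]
        congr 1; push_cast; ring
      have hpos : 0 ≤ ε * T ^ (|p| + |p + 1| + 2) * T ^ E := by positivity
      calc κ = κ * T⁻¹ * T := by field_simp
        _ ≤ ε * 4 * T ^ (|p| + |p + 1| + 2) * T ^ E * T := by gcongr
        _ = ε * T ^ (|p| + |p + 1| + 2) * T ^ E * (4 * T) := by ring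
        _ ≤ ε * T ^ (|p| + |p + 1| + 2) * T ^ E * T ^ 3 := by
          gcongr
          nlinarith [mul_pos hT0 hT0]
        _ = _ := by rw [e]; ring

lemma sep_measure (δ : ℝ) (hδ : 0 < δ) (a : ℝ) (K : ℕ) : ∀ S : Set ℝ, (∀ y ∈ S, a ≤ y) →
    (∃ x : ℕ → ℝ, (∀ i < K, x i ∈ S) ∧ ∀ i, i + 1 < K → x i + δ ≤ x (i + 1)) ∨
    MeasureTheory.volume S ≤ ENNReal.ofReal (2 * K * δ) := by
  induction K with
  | zero => intro S _; left; exact ⟨fun _ => 0, by simp, by simp⟩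
  | succ K ih =>
    intro S hS
    rcases S.eq_empty_or_nonempty with rfl | hne
    · right; simp
    have hbdd : BddBelow S := ⟨a, hS⟩
    obtain ⟨x0, hx0, hlt⟩ := exists_lt_of_csInf_lt hne (lt_add_of_pos_right (sInf S) hδ)
    rcases ih (S ∩ Set.Ici (x0 + δ)) (fun y hy => hS y hy.1) with ⟨x, h1, h2⟩ | h
    · left
      refine ⟨fun i => Nat.casesOn i x0 x, ?_, ?_⟩
      · intro i hi
        cases i with
        | zero => exact hx0
        | succ i => exact (h1 i (by omega)).1
      · intro i hi
        cases i with
        | zero => exact (h1 0 (by omega)).2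
        | succ i => exact h2 i (by omega)
    · right
      have hsub : S ⊆ Set.Icc (sInf S) (sInf S + 2 * δ) ∪ (S ∩ Set.Ici (x0 + δ)) := by
        intro y hy
        by_cases hyx : x0 + δ ≤ y
        · exact Or.inr ⟨hy, hyx⟩
        · exact Or.inl ⟨csInf_le hbdd hy, by linarith [not_le.mp hyx]⟩
      calc MeasureTheory.volume S ≤ _ := MeasureTheory.measure_mono hsub
        _ ≤ _ := MeasureTheory.measure_union_le _ _
        _ ≤ ENNReal.ofReal (2 * δ) + ENNReal.ofReal (2 * K * δ) := by
          gcongr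
          rw [Real.volume_Icc]
          apply ENNReal.ofReal_le_ofReal; linarith
        _ = _ := by
          rw [← ENNReal.ofReal_add (by positivity) (by positivity)]
          congr 1; push_cast; ring

lemma group_sum {r : ℕ} (u : Fin r → ℝ) (σ : Fin r → ℤ) (F : ℝ → ℝ) :
    ∑ l, (σ l : ℝ) * F (u l) =
      ∑ v ∈ (Finset.univ.image u).filter
        (fun v => (∑ l ∈ Finset.univ.filter (fun l => u l = v), σ l) ≠ 0),
        ((∑ l ∈ Finset.univ.filter (fun l => u l = v), σ l : ℤ) : ℝ) * F v := by
  have h1 : ∑ l, (σ l : ℝ) * F (u l) = ∑ v ∈ Finset.univ.image u,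
      ((∑ l ∈ Finset.univ.filter (fun l => u l = v), σ l : ℤ) : ℝ) * F v := by
    rw [← Finset.sum_fiberwise_of_maps_to (s := Finset.univ) (t := Finset.univ.image u) (g := u)
      (fun l _ => Finset.mem_image_of_mem u (Finset.mem_univ l))]
    refine Finset.sum_congr rfl fun v _ => ?_
    push_cast
    rw [Finset.sum_mul]
    refine Finset.sum_congr rfl fun l hl => ?_
    rw [(Finset.mem_filter.mp hl).2]
  rw [h1, Finset.sum_filter]
  refine Finset.sum_congr rfl fun v _ => ?_
  split_ifs with h
  · rfl
  · rw [not_not] at h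
    rw [h]; simp

lemma tuple (r : ℕ) : ∃ E : ℝ, 0 ≤ E ∧ ∀ (T m β₁ β₂ δ : ℝ) (u : Fin r → ℝ) (σ : Fin r → ℤ),
    2 ≤ T → 0 < m → T⁻¹ ≤ m → 0 < β₁ → 0 < δ → T⁻¹ ≤ β₁ ^ 3 * δ →
    (∀ l, 0 ≤ u l ∧ β₂ ^ 4 * u l + m ≤ T) →
    (∀ l l', u l ≠ u l' → T⁻¹ ≤ |u l - u l'|) →
    (∃ v, (∑ l ∈ Finset.univ.filter (fun l => u l = v), σ l) ≠ 0) →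
    MeasureTheory.volume {β | β ∈ Set.Ioo β₁ β₂ ∧
      |∑ l, (σ l : ℝ) * Real.sqrt (β ^ 4 * u l + m)| < T ^ (-E) / 2} ≤
      ENNReal.ofReal (2 * (2 ^ r : ℕ) * δ) := by
  obtain ⟨E, hE, H⟩ := key r (1 / 2) (by
    intro n
    rcases Nat.eq_zero_or_pos n with rfl | hn
    · norm_num
    · have : (1 : ℝ) ≤ n := by exact_mod_cast hn
      rw [abs_of_nonpos (by linarith)]; linarith)
  refine ⟨E, hE, ?_⟩
  intro T m β₁ β₂ δ u σ hT hm hmT hβ₁ hδ hTδ hu hsep hnd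
  have hT0 : 0 < T := by linarith
  rcases sep_measure δ hδ β₁ (2 ^ r) {β | β ∈ Set.Ioo β₁ β₂ ∧
      |∑ l, (σ l : ℝ) * Real.sqrt (β ^ 4 * u l + m)| < T ^ (-E) / 2}
      (fun y hy => hy.1.1.le) with ⟨x, h1, h2⟩ | h
  · exfalso
    set s := (Finset.univ.image u).filter
        (fun v => (∑ l ∈ Finset.univ.filter (fun l => u l = v), σ l) ≠ 0) with hs
    have hmem : ∀ v ∈ s, ∃ l, u l = v := by
      intro v hv
      have := (Finset.mem_filter.mp hv).1
      simpa using this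
    have hfin := H T m (β₂ ^ 4) 1 (T ^ (-E) / 2) s
      (fun v => ((∑ l ∈ Finset.univ.filter (fun l => u l = v), σ l : ℤ) : ℝ))
      (fun i => x i ^ 4) hT hm hmT
      (by
        obtain ⟨v, hv⟩ := hnd
        refine ⟨v, Finset.mem_filter.mpr ⟨?_, hv⟩⟩
        obtain ⟨l, hl, _⟩ := Finset.exists_ne_zero_of_sum_ne_zero hv
        exact Finset.mem_image.mpr ⟨l, Finset.mem_univ _, (Finset.mem_filter.mp hl).2⟩)
      (by
        calc s.card ≤ (Finset.univ.image u).card := Finset.card_filter_le _ _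
          _ ≤ (Finset.univ : Finset (Fin r)).card := Finset.card_image_le
          _ = r := by simp
          _ ≤ r + 1 := by omega)
      (by
        intro v hv
        obtain ⟨l, rfl⟩ := hmem v hv
        exact hu l)
      (by
        intro v hv w hw hne
        obtain ⟨l, rfl⟩ := hmem v hv
        obtain ⟨l', rfl⟩ := hmem w hw
        exact hsep l l' hne)
      zero_le_one
      (by
        intro v hv
        have := Int.one_le_abs (Finset.mem_filter.mp hv).2
        exact_mod_cast this)
      (by
        intro i hi
        have := (h1 i hi).1
        have h0 : 0 < x i := hβ₁.trans this.1
        exact ⟨by positivity, by gcongr; exact this.2.le⟩)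
      (by
        intro i hi
        have a1 := (h1 i (by omega)).1.1
        have a2 := h2 i hi
        have h3 : 0 < x i := hβ₁.trans a1
        have h4 : (x i + δ) ^ 4 ≤ x (i + 1) ^ 4 := by gcongr
        have h5 : β₁ ^ 3 ≤ x i ^ 3 := by gcongr
        have h6 : β₁ ^ 3 * δ ≤ x i ^ 3 * δ := by gcongr
        have h7 : (x i + δ) ^ 4 = x i ^ 4 + x i ^ 3 * δ + (3 * x i ^ 3 * δ + 6 * x i ^ 2 * δ ^ 2
          + 4 * x i * δ ^ 3 + δ ^ 4) := by ring
        have h8 : 0 ≤ 3 * x i ^ 3 * δ + 6 * x i ^ 2 * δ ^ 2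
          + 4 * x i * δ ^ 3 + δ ^ 4 := by positivity
        show x i ^ 4 + T⁻¹ ≤ x (i + 1) ^ 4
        linarith)
      (by
        intro i hi
        have := (h1 i hi).2.le
        rw [group_sum u σ (fun v => Real.sqrt (x i ^ 4 * v + m))] at this
        simpa only [Real.sqrt_eq_rpow] using this)
    have e : T ^ (-E) / 2 * T ^ E = 1 / 2 := by
      rw [div_mul_eq_mul_div, ← Real.rpow_add hT0]; simp
    rw [e] at hfin
    norm_num at hfin
  · exact_mod_cast h

lemma coord_le {d : ℕ} {j : Zd d} {N : ℕ} (h : enorm j ≤ N) (i : Fin d) : |(j i : ℝ)| ≤ N := by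
  rw [← Real.sqrt_sq_eq_abs]
  refine le_trans (Real.sqrt_le_sqrt ?_) h
  exact Finset.single_le_sum (f := fun i => ((j i : ℝ)) ^ 2) (fun _ _ => sq_nonneg _)
    (Finset.mem_univ i)

lemma qform_bd {d : ℕ} (g : Fin d → Fin d → ℝ) {j : Zd d} {R : ℝ} (hR : 0 ≤ R)
    (h : ∀ i, |(j i : ℝ)| ≤ R) : |qform d g j| ≤ (∑ i, ∑ k, |g i k|) * R ^ 2 := by
  unfold qform
  rw [Finset.sum_mul]
  refine (Finset.abs_sum_le_sum_abs _ _).trans (Finset.sum_le_sum fun i _ => ?_)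
  rw [Finset.sum_mul]
  refine (Finset.abs_sum_le_sum_abs _ _).trans (Finset.sum_le_sum fun k _ => ?_)
  rw [abs_mul, abs_mul, mul_assoc, sq]
  gcongr
  · exact h i
  · exact h k

lemma qform_tri {d : ℕ} (g : Fin d → Fin d → ℝ) (hsym : ∀ i k, g i k = g k i) (w : Fin d → Fin d → ℝ)
    (hw : ∀ i k, w i k = w k i) :
    ∑ i, ∑ k, g i k * w i k =
      ∑ i, ∑ k, if i ≤ k then g i k * ((if i = k then 1 else 2) * w i k) else 0 := by
  have hsplit : ∀ i k, g i k * w i k = (if i ≤ k then g i k * w i k else 0) +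
      (if k < i then g i k * w i k else 0) := by
    intro i k
    by_cases h : i ≤ k
    · simp [h, not_lt.mpr h]
    · simp [h, not_le.mp h]
  have h2 : ∑ i, ∑ k, (if k < i then g i k * w i k else 0) =
      ∑ i, ∑ k, (if i < k then g i k * w i k else 0) := by
    rw [Finset.sum_comm]
    refine Finset.sum_congr rfl fun i _ => Finset.sum_congr rfl fun k _ => ?_
    rw [hsym k i, hw k i]
  calc _ = ∑ i, ∑ k, ((if i ≤ k then g i k * w i k else 0) +
      (if k < i then g i k * w i k else 0)) :=
        Finset.sum_congr rfl fun i _ => Finset.sum_congr rfl fun k _ => hsplit i k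
    _ = ∑ i, ∑ k, ((if i ≤ k then g i k * w i k else 0) +
      (if i < k then g i k * w i k else 0)) := by
        simp only [Finset.sum_add_distrib]; rw [h2]
    _ = _ := by
        refine Finset.sum_congr rfl fun i _ => Finset.sum_congr rfl fun k _ => ?_
        rcases lt_trichotomy i k with h | h | h
        · simp [h, h.le, h.ne]; ring
        · simp [h]
        · simp [not_le.mpr h, not_lt.mpr h.le]

lemma qform_nonneg {d : ℕ} (g : Fin d → Fin d → ℝ)
    (hpos : ∀ x : Fin d → ℝ, x ≠ 0 → 0 < ∑ i, ∑ k, g i k * x i * x k) (j : Zd d) :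
    0 ≤ qform d g j := by
  by_cases h : (fun i => (j i : ℝ)) = 0
  · have : ∀ i, (j i : ℝ) = 0 := fun i => congrFun h i
    simp [qform, this]
  · exact (hpos _ h).le

lemma dio {d : ℕ} (g : Fin d → Fin d → ℝ) (hsym : ∀ i k, g i k = g k i) {γ : ℝ} (hγ : 0 < γ)
    (hD : Diophantine d g γ) {j j' : Zd d} {N : ℕ}
    (hj : ∀ i, |(j i : ℝ)| ≤ N) (hj' : ∀ i, |(j' i : ℝ)| ≤ N) (hne : qform d g j ≠ qform d g j') :
    γ / (4 * d ^ 2 * N ^ 2 : ℝ) ^ tauStar d ≤ |qform d g j - qform d g j'| := by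
  set ℓ : Fin d → Fin d → ℤ := fun i k => (if i = k then 1 else 2) * (j i * j k - j' i * j' k)
    with hℓ
  have hq : qform d g j - qform d g j' = ∑ i, ∑ k, if i ≤ k then g i k * (ℓ i k : ℝ) else 0 := by
    have h1 := qform_tri g hsym (fun i k => (j i : ℝ) * j k - j' i * j' k) (fun i k => by ring)
    have h2 : qform d g j - qform d g j' =
        ∑ i, ∑ k, g i k * ((j i : ℝ) * j k - j' i * j' k) := by
      unfold qform
      rw [← Finset.sum_sub_distrib]
      refine Finset.sum_congr rfl fun i _ => ?_
      rw [← Finset.sum_sub_distrib]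
      refine Finset.sum_congr rfl fun k _ => by ring
    rw [h2, h1]
    refine Finset.sum_congr rfl fun i _ => Finset.sum_congr rfl fun k _ => ?_
    simp only [hℓ]; push_cast; rfl
  have hex : ∃ i k, i ≤ k ∧ ℓ i k ≠ 0 := by
    by_contra hcon
    push Not at hcon
    apply hne
    rw [← sub_eq_zero, hq]
    refine Finset.sum_eq_zero fun i _ => Finset.sum_eq_zero fun k _ => ?_
    split_ifs with h
    · rw [hcon i k h]; simp
    · rfl
  have hmain := hD ℓ hex
  rw [← hq] at hmain
  refine le_trans ?_ hmain
  have hterm : ∀ i k, (|ℓ i k| : ℝ) ≤ 4 * N ^ 2 := by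
    intro i k
    simp only [hℓ]
    push_cast
    rw [abs_mul]
    have h1 : |(if i = k then (1 : ℝ) else 2)| ≤ 2 := by split_ifs <;> norm_num
    have h2 : |(j i : ℝ) * j k - j' i * j' k| ≤ 2 * N ^ 2 := by
      calc _ ≤ |(j i : ℝ) * j k| + |(j' i : ℝ) * j' k| := abs_sub _ _
        _ ≤ (N : ℝ) * N + N * N := by
          rw [abs_mul, abs_mul]
          gcongr
          · exact hj i
          · exact hj k
          · exact hj' i
          · exact hj' k
        _ = _ := by ring
    calc _ ≤ 2 * (2 * (N : ℝ) ^ 2) := by gcongr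
      _ = _ := by ring
  have hnn : ∀ i k, 0 ≤ (if i ≤ k then (|ℓ i k| : ℝ) else 0) := by
    intro i k; split_ifs <;> positivity
  have hle : (∑ i, ∑ k, if i ≤ k then (|ℓ i k| : ℝ) else 0) ≤ 4 * d ^ 2 * N ^ 2 := by
    calc _ ≤ ∑ i : Fin d, ∑ k : Fin d, (4 * (N : ℝ) ^ 2) := by
          refine Finset.sum_le_sum fun i _ => Finset.sum_le_sum fun k _ => ?_
          split_ifs
          · exact hterm i k
          · positivity
      _ = _ := by simp; ring
  have hposs : 0 < ∑ i, ∑ k, if i ≤ k then (|ℓ i k| : ℝ) else 0 := by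
    obtain ⟨i, k, hik, h0⟩ := hex
    refine Finset.sum_pos' (fun i _ => Finset.sum_nonneg fun k _ => hnn i k)
      ⟨i, Finset.mem_univ _, Finset.sum_pos' (fun k _ => hnn i k) ⟨k, Finset.mem_univ _, ?_⟩⟩
    rw [if_pos hik]
    have : (ℓ i k : ℝ) ≠ 0 := by exact_mod_cast h0
    positivity
  gcongr

lemma dio_sq {d : ℕ} (g : Fin d → Fin d → ℝ) (hsym : ∀ i k, g i k = g k i)
    (hpos : ∀ x : Fin d → ℝ, x ≠ 0 → 0 < ∑ i, ∑ k, g i k * x i * x k) {γ : ℝ} (hγ : 0 < γ)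
    (hD : Diophantine d g γ) {j j' : Zd d} {N : ℕ}
    (hj : ∀ i, |(j i : ℝ)| ≤ N) (hj' : ∀ i, |(j' i : ℝ)| ≤ N)
    (hne : qform d g j ^ 2 ≠ qform d g j' ^ 2) :
    (γ / (4 * d ^ 2 * N ^ 2 : ℝ) ^ tauStar d) ^ 2 ≤ |qform d g j ^ 2 - qform d g j' ^ 2| := by
  have h := dio g hsym hγ hD hj hj' (fun h => hne (by rw [h]))
  have h1 := qform_nonneg g hpos j
  have h2 := qform_nonneg g hpos j'
  have h3 : |qform d g j - qform d g j'| ≤ qform d g j + qform d g j' := by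
    rw [abs_le]; constructor <;> linarith
  have e : qform d g j ^ 2 - qform d g j' ^ 2 =
    (qform d g j - qform d g j') * (qform d g j + qform d g j') := by ring
  rw [e, abs_mul, abs_of_nonneg (add_nonneg h1 h2), sq]
  have h0 : 0 ≤ γ / (4 * d ^ 2 * N ^ 2 : ℝ) ^ tauStar d := by positivity
  exact mul_le_mul h (h.trans h3) h0 (abs_nonneg _)

lemma qform_lower {d : ℕ} (g : Fin d → Fin d → ℝ)
    (hpos : ∀ x : Fin d → ℝ, x ≠ 0 → 0 < ∑ i, ∑ k, g i k * x i * x k) :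
    ∃ c : ℝ, 0 < c ∧ ∀ j : Zd d, c * enorm j ^ 2 ≤ qform d g j := by
  set Q : (Fin d → ℝ) → ℝ := fun x => ∑ i, ∑ k, g i k * x i * x k with hQ
  have hQc : Continuous Q := by fun_prop
  have hcomp : IsCompact {x : Fin d → ℝ | ∑ i, x i ^ 2 = 1} := by
    apply Metric.isCompact_of_isClosed_isBounded
    · exact isClosed_eq (by fun_prop) continuous_const
    · refine (Metric.isBounded_closedBall (x := (0 : Fin d → ℝ)) (r := 1)).subset ?_
      intro x hx
      rw [mem_closedBall_zero_iff, pi_norm_le_iff_of_nonneg zero_le_one]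
      intro i
      rw [Real.norm_eq_abs, ← sq_le_one_iff_abs_le_one, ← (show ∑ i, x i ^ 2 = 1 from hx)]
      exact Finset.single_le_sum (f := fun i => x i ^ 2) (fun _ _ => sq_nonneg _)
        (Finset.mem_univ i)
  have hex : ∃ c : ℝ, 0 < c ∧ ∀ x ∈ {x : Fin d → ℝ | ∑ i, x i ^ 2 = 1}, c ≤ Q x := by
    rcases Set.eq_empty_or_nonempty {x : Fin d → ℝ | ∑ i, x i ^ 2 = 1} with he | hne
    · exact ⟨1, one_pos, by rw [he]; simp⟩
    · obtain ⟨x0, hx0, hmin⟩ := hcomp.exists_isMinOn hne hQc.continuousOn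
      refine ⟨Q x0, hpos x0 ?_, fun x hx => hmin hx⟩
      rintro rfl
      simp at hx0
  obtain ⟨c, hc, hcQ⟩ := hex
  refine ⟨c, hc, fun j => ?_⟩
  have hn : enorm j ^ 2 = ∑ i, ((j i : ℝ)) ^ 2 :=
    Real.sq_sqrt (Finset.sum_nonneg fun _ _ => sq_nonneg _)
  rcases eq_or_ne (enorm j) 0 with h0 | h0
  · rw [h0]; simpa using qform_nonneg g hpos j
  · have h1 := hcQ (fun i => (j i : ℝ) / enorm j) (by
      show ∑ i, ((j i : ℝ) / enorm j) ^ 2 = 1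
      simp only [div_pow]
      rw [← Finset.sum_div, ← hn]
      exact div_self (by positivity))
    have h2 : Q (fun i => (j i : ℝ) / enorm j) = qform d g j / enorm j ^ 2 := by
      simp only [hQ, qform, Finset.sum_div]
      refine Finset.sum_congr rfl fun i _ => Finset.sum_congr rfl fun k _ => ?_
      field_simp
    rw [h2, le_div_iff₀ (by positivity)] at h1
    exact h1

lemma omega_inj {d : ℕ} (g : Fin d → Fin d → ℝ)
    (hpos : ∀ x : Fin d → ℝ, x ≠ 0 → 0 < ∑ i, ∑ k, g i k * x i * x k)
    {m β : ℝ} (hm : 0 < m) (hβ : 0 < β) {i j : Zd d}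
    (h : beamOmega d g m β j = beamOmega d g m β i) : qform d g j = qform d g i := by
  unfold beamOmega at h
  rw [Real.sqrt_inj (by positivity) (by positivity)] at h
  have h1 : β ^ 4 * qform d g j ^ 2 = β ^ 4 * qform d g i ^ 2 := by linarith
  have h2 := mul_left_cancel₀ (by positivity) h1
  exact (pow_left_inj₀ (qform_nonneg g hpos j) (qform_nonneg g hpos i) two_ne_zero).mp h2

lemma dyadic {d : ℕ} (g : Fin d → Fin d → ℝ)
    (hpos : ∀ x : Fin d → ℝ, x ≠ 0 → 0 < ∑ i, ∑ k, g i k * x i * x k) :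
    ∃ C : ℝ, 0 < C ∧ ∀ j k : Zd d, qform d g j = qform d g k → enorm j ≤ C * enorm k := by
  obtain ⟨c, hc, h⟩ := qform_lower g hpos
  set G := ∑ i, ∑ k, |g i k| with hG
  have hG0 : 0 ≤ G := by positivity
  refine ⟨Real.sqrt ((G + 1) / c), by positivity, fun j k hjk => ?_⟩
  have he : ∀ j : Zd d, 0 ≤ enorm j := fun j => Real.sqrt_nonneg _
  have hk : ∀ i, |(k i : ℝ)| ≤ enorm k := by
    intro i
    rw [← Real.sqrt_sq_eq_abs]
    refine Real.sqrt_le_sqrt ?_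
    exact Finset.single_le_sum (f := fun i => ((k i : ℝ)) ^ 2) (fun _ _ => sq_nonneg _)
      (Finset.mem_univ i)
  have h1 := (le_abs_self _).trans (qform_bd g (he k) hk)
  have h2 := h j
  rw [hjk] at h2
  refine abs_le_of_sq_le_sq' ?_ (by have := he k; positivity) |>.2
  rw [mul_pow, Real.sq_sqrt (by positivity), div_mul_eq_mul_div, le_div_iff₀ hc]
  nlinarith [sq_nonneg (enorm k)]

/-- the resonant set at scale `N` -/
def Bad (d : ℕ) (g : Fin d → Fin d → ℝ) (m β₁ β₂ : ℝ) (r : ℕ) (ε : ℝ) (N : ℕ) : Set ℝ :=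
  {β | β ∈ Set.Ioo β₁ β₂ ∧ ∃ (j : Fin r → Zd d) (σ : Fin r → ℤ), (∀ l, σ l = 1 ∨ σ l = -1) ∧
    (∀ l, enorm (j l) ≤ (N : ℝ)) ∧
    (∃ v, (∑ l ∈ Finset.univ.filter (fun l => qform d g (j l) ^ 2 = v), σ l) ≠ 0) ∧
    |∑ l, (σ l : ℝ) * beamOmega d g m β (j l)| < ε}

lemma bad_measure {d : ℕ} {g : Fin d → Fin d → ℝ} {m β₁ β₂ : ℝ} {r : ℕ} {ε : ℝ} {N : ℕ}
    (hN : 1 ≤ N) {K : ℝ} (hK : 0 ≤ K)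
    (H : ∀ (j : Fin r → Zd d) (σ : Fin r → ℤ), (∀ l, enorm (j l) ≤ (N : ℝ)) →
      (∃ v, (∑ l ∈ Finset.univ.filter (fun l => qform d g (j l) ^ 2 = v), σ l) ≠ 0) →
      MeasureTheory.volume {β | β ∈ Set.Ioo β₁ β₂ ∧
        |∑ l, (σ l : ℝ) * beamOmega d g m β (j l)| < ε} ≤ ENNReal.ofReal K) :
    MeasureTheory.volume (Bad d g m β₁ β₂ r ε N) ≤
      ENNReal.ofReal ((3 * N) ^ (d * r) * 2 ^ r * K) := by
  classical
  set P : Finset ((Fin r → Zd d) × (Fin r → ℤ)) :=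
    (Fintype.piFinset fun _ => Fintype.piFinset fun _ => Finset.Icc (-(N : ℤ)) N) ×ˢ
      (Fintype.piFinset fun _ => {1, -1}) with hP
  set B : (Fin r → Zd d) × (Fin r → ℤ) → Set ℝ := fun q => {β | (∀ l, enorm (q.1 l) ≤ (N : ℝ)) ∧
    (∃ v, (∑ l ∈ Finset.univ.filter (fun l => qform d g (q.1 l) ^ 2 = v), q.2 l) ≠ 0) ∧
    β ∈ Set.Ioo β₁ β₂ ∧ |∑ l, (q.2 l : ℝ) * beamOmega d g m β (q.1 l)| < ε} with hB
  have hsub : Bad d g m β₁ β₂ r ε N ⊆ ⋃ q ∈ P, B q := by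
    rintro β ⟨hβ, j, σ, h1, h2, h3, h4⟩
    simp only [Set.mem_iUnion]
    refine ⟨(j, σ), ?_, h2, h3, hβ, h4⟩
    simp only [hP, Finset.mem_product, Fintype.mem_piFinset, Finset.mem_Icc, Finset.mem_insert,
      Finset.mem_singleton]
    refine ⟨fun l i => ?_, h1⟩
    have := coord_le (h2 l) i
    rw [← abs_le]
    exact_mod_cast this
  have hBm : ∀ q ∈ P, MeasureTheory.volume (B q) ≤ ENNReal.ofReal K := by
    intro q _
    by_cases hq : (∀ l, enorm (q.1 l) ≤ (N : ℝ)) ∧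
      (∃ v, (∑ l ∈ Finset.univ.filter (fun l => qform d g (q.1 l) ^ 2 = v), q.2 l) ≠ 0)
    · refine (MeasureTheory.measure_mono ?_).trans (H q.1 q.2 hq.1 hq.2)
      rintro β ⟨_, _, h⟩
      exact h
    · have : B q = ∅ := by
        ext β
        simp only [Set.mem_empty_iff_false, iff_false]
        rintro ⟨h1, h2, _⟩
        exact hq ⟨h1, h2⟩
      rw [this]; simp
  have hcard : (P.card : ℝ) ≤ (3 * N) ^ (d * r) * 2 ^ r := by
    have : P.card = ((2 * N + 1) ^ d) ^ r * 2 ^ r := by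
      rw [hP, Finset.card_product, Fintype.card_piFinset, Fintype.card_piFinset]
      have h1 : ((N : ℤ) + 1 + N).toNat = 2 * N + 1 := by omega
      simp [Fintype.card_piFinset, h1]
    rw [this, ← pow_mul]
    push_cast
    have : (1 : ℝ) ≤ N := by exact_mod_cast hN
    gcongr
    linarith
  calc _ ≤ MeasureTheory.volume (⋃ q ∈ P, B q) := MeasureTheory.measure_mono hsub
    _ ≤ ∑ q ∈ P, MeasureTheory.volume (B q) := MeasureTheory.measure_biUnion_finset_le _ _
    _ ≤ ∑ q ∈ P, ENNReal.ofReal K := Finset.sum_le_sum hBm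
    _ = ENNReal.ofReal (P.card * K) := by
      rw [Finset.sum_const, nsmul_eq_mul, ENNReal.ofReal_mul (by positivity),
        ENNReal.ofReal_natCast]
    _ ≤ _ := by
      apply ENNReal.ofReal_le_ofReal
      gcongr

lemma inv_le_of_piece {A P n : ℝ} {a b : ℕ} (hP : 0 < P) (hPA : P ≤ A) (hn : 1 ≤ n) (hab : b ≤ a) :
    (A * n ^ a)⁻¹ ≤ (P * n ^ b)⁻¹ := by
  have : 0 < n := by linarith
  have hA : 0 ≤ A := by linarith
  gcongr

lemma good {d : ℕ} (g : Fin d → Fin d → ℝ) (hd : 1 ≤ d) (hsym : ∀ i k, g i k = g k i)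
    (hpos : ∀ x : Fin d → ℝ, x ≠ 0 → 0 < ∑ i, ∑ k, g i k * x i * x k) {γ : ℝ} (hγ : 0 < γ)
    (hD : Diophantine d g γ) {β₁ β₂ m : ℝ} (hβ₁ : 0 < β₁) (hm : 0 < m) (r : ℕ) :
    ∃ A : ℝ, 1 ≤ A ∧ ∃ a : ℕ, ∃ E : ℝ, 0 ≤ E ∧ ∀ᵐ β : ℝ, ∃ N₀ : ℕ, 1 ≤ N₀ ∧ ∀ N : ℕ, N₀ ≤ N →
      β ∉ Bad d g m β₁ β₂ r ((A * N ^ a) ^ (-E) / 2) N := by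
  obtain ⟨E, hE, H⟩ := tuple r
  set G := ∑ i, ∑ k, |g i k| with hG
  have hG0 : 0 ≤ G := by positivity
  have hd0 : (0 : ℝ) < d := by exact_mod_cast hd
  set t := tauStar d with ht
  set P : ℝ := ((4 * d ^ 2 : ℝ) ^ t) ^ 2 / γ ^ 2 with hP
  have hP0 : 0 < P := by positivity
  set A : ℝ := 2 + m⁻¹ + (β₂ ^ 4 * G ^ 2 + m) + P + (β₁ ^ 3)⁻¹ with hA
  have hb4 : 0 ≤ β₂ ^ 4 := by positivity
  have hmi : 0 < m⁻¹ := by positivity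
  have hbi : 0 < (β₁ ^ 3)⁻¹ := by positivity
  have hbG : 0 ≤ β₂ ^ 4 * G ^ 2 := by positivity
  have hA2 : 2 ≤ A := by linarith
  set a : ℕ := 4 + 4 * t + (d * r + 2) with ha
  refine ⟨A, by linarith, a, E, hE, ?_⟩
  have hmeas : ∀ N : ℕ, 1 ≤ N → MeasureTheory.volume
      (Bad d g m β₁ β₂ r ((A * N ^ a) ^ (-E) / 2) N) ≤
      ENNReal.ofReal (3 ^ (d * r) * 2 ^ r * (2 * 2 ^ r) * (1 / (N : ℝ) ^ 2)) := by
    intro N hN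
    have hN1 : (1 : ℝ) ≤ N := by exact_mod_cast hN
    have hN0 : (0 : ℝ) < N := by linarith
    have hNa : (1 : ℝ) ≤ (N : ℝ) ^ a := one_le_pow₀ hN1
    have hbm := bad_measure (d := d) (g := g) (m := m) (β₁ := β₁) (β₂ := β₂) (r := r)
      (ε := (A * N ^ a) ^ (-E) / 2) hN (K := 2 * (2 ^ r : ℕ) * ((N : ℝ) ^ (d * r + 2))⁻¹)
      (by positivity) (by
        intro j σ hj hnd
        refine H (A * N ^ a) m β₁ β₂ ((N : ℝ) ^ (d * r + 2))⁻¹ (fun l => qform d g (j l) ^ 2) σ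
          (by nlinarith) hm ?_ hβ₁ (by positivity) ?_ ?_ ?_ hnd
        · have := inv_le_of_piece (A := A) (a := a) (b := 0) hmi (by linarith) hN1 (by omega)
          simpa using this
        · have := inv_le_of_piece (A := A) (a := a) (b := d * r + 2) hbi (by linarith) hN1 (by omega)
          rwa [mul_inv (β₁ ^ 3)⁻¹, inv_inv] at this
        · intro l
          refine ⟨sq_nonneg _, ?_⟩
          have h1 := qform_bd g hN0.le (coord_le (hj l))
          have h2 : qform d g (j l) ^ 2 ≤ (G * N ^ 2) ^ 2 := by
            rw [← sq_abs]; gcongr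
          have h3 : (N : ℝ) ^ 4 ≤ (N : ℝ) ^ a := pow_le_pow_right₀ hN1 (by omega)
          calc β₂ ^ 4 * qform d g (j l) ^ 2 + m ≤ β₂ ^ 4 * (G * N ^ 2) ^ 2 + m := by gcongr
            _ = β₂ ^ 4 * G ^ 2 * N ^ 4 + m * 1 := by ring
            _ ≤ β₂ ^ 4 * G ^ 2 * N ^ a + m * N ^ a := by gcongr
            _ = (β₂ ^ 4 * G ^ 2 + m) * N ^ a := by ring
            _ ≤ A * N ^ a := by gcongr; linarith
        · intro l l' hne
          refine le_trans ?_ (dio_sq g hsym hpos hγ hD (coord_le (hj l)) (coord_le (hj l')) hne)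
          have := inv_le_of_piece (A := A) (a := a) (b := 4 * t) hP0 (by linarith) hN1 (by omega)
          refine this.trans (le_of_eq ?_)
          rw [hP, ← ht]
          rw [mul_pow (4 * (d : ℝ) ^ 2), ← pow_mul (N : ℝ) 2 t]
          rw [div_pow, mul_pow _ ((N : ℝ) ^ (2 * t)), ← pow_mul (N : ℝ) (2 * t) 2, show 2 * t * 2 = 4 * t by ring]
          field_simp)
    refine hbm.trans (le_of_eq ?_)
    congr 1
    push_cast
    rw [mul_pow, pow_add]
    field_simp
  have hsum : Summable (fun N : ℕ => 3 ^ (d * r) * 2 ^ r * (2 * 2 ^ r) *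
      (1 / ((N + 1 : ℕ) : ℝ) ^ 2)) := by
    apply Summable.mul_left
    exact (summable_nat_add_iff 1).mpr (Real.summable_one_div_nat_pow.mpr (by norm_num))
  have hBC := MeasureTheory.ae_eventually_notMem (μ := (MeasureTheory.volume : MeasureTheory.Measure ℝ))
    (s := fun N : ℕ => Bad d g m β₁ β₂ r ((A * ((N + 1 : ℕ) : ℝ) ^ a) ^ (-E) / 2) (N + 1))
    (by
      refine ne_top_of_le_ne_top hsum.tsum_ofReal_ne_top
        (ENNReal.tsum_le_tsum fun N => hmeas (N + 1) (by omega)))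
  filter_upwards [hBC] with β hβ
  obtain ⟨M, hM⟩ := Filter.eventually_atTop.mp hβ
  refine ⟨M + 1, by omega, fun N hN => ?_⟩
  obtain ⟨n, rfl⟩ : ∃ n, N = n + 1 := ⟨N - 1, by omega⟩
  exact hM n (by omega)

lemma nondeg_of_ne {d r : ℕ} (g : Fin d → Fin d → ℝ) (m β : ℝ) (j : Fin r → Zd d) (σ : Fin r → ℤ)
    (h : (∑ l, (σ l : ℝ) * beamOmega d g m β (j l)) ≠ 0) :
    ∃ v, (∑ l ∈ Finset.univ.filter (fun l => qform d g (j l) ^ 2 = v), σ l) ≠ 0 := by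
  by_contra hcon
  push Not at hcon
  apply h
  unfold beamOmega
  rw [group_sum (fun l => qform d g (j l) ^ 2) σ (fun v => Real.sqrt (β ^ 4 * v + m))]
  refine Finset.sum_eq_zero fun v _ => ?_
  simp [hcon v]

/-- Lemma `non.beam`.
For an admissible metric `ḡ` and `m > 0` there is a zero-measure set
`ℬ^{res} ⊂ (β₁,β₂)` such that for `β ∉ ℬ^{res}` the frequencies
`ω_j(β) = √(β⁴|j|_ḡ⁴+m)` satisfy (F.2), (NR.1) and (NR.2). -/
theorem stmt_16 (d : ℕ) (hd : 1 ≤ d)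
    (gbar : Fin d → Fin d → ℝ) (hsym : ∀ i k, gbar i k = gbar k i)
    (hpos : ∀ x : Fin d → ℝ, x ≠ 0 → 0 < ∑ i, ∑ k, gbar i k * x i * x k)
    (hadm : ∃ γ₀ : ℝ, 0 < γ₀ ∧ Diophantine d gbar γ₀)
    (β₁ β₂ : ℝ) (hβ₁ : 0 < β₁) (hβ₁₂ : β₁ < β₂) (m : ℝ) (hm : 0 < m) :
    ∃ Bres : Set ℝ, Bres ⊆ Set.Ioo β₁ β₂ ∧ MeasureTheory.volume Bres = 0 ∧
      ∀ β ∈ Set.Ioo β₁ β₂, β ∉ Bres →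
        -- (F.2)
        (∀ r : ℕ, 3 ≤ r → ∃ γ : ℝ, 0 < γ ∧ ∃ τ : ℝ, ∀ N : ℕ, 1 ≤ N →
          ∀ (j : Fin r → Zd d) (σ : Fin r → ℤ),
            (∀ l, σ l = 1 ∨ σ l = -1) → (∀ l, enorm (j l) ≤ (N : ℝ)) →
            (∑ l, (σ l : ℝ) * beamOmega d gbar m β (j l)) ≠ 0 →
            γ / (N : ℝ) ^ τ ≤ |∑ l, (σ l : ℝ) * beamOmega d gbar m β (j l)|) ∧
        -- (NR.1): the equivalence classes of `ω` are dyadic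
        (∃ C : ℝ, 0 < C ∧ ∀ i j k : Zd d,
          beamOmega d gbar m β j = beamOmega d gbar m β i →
          beamOmega d gbar m β k = beamOmega d gbar m β i →
          enorm j ≤ C * enorm k) ∧
        -- (NR.2)
        (∀ l : ℕ, 1 ≤ l → ∀ (j : Fin l → Zd d) (σ : Fin l → ℤ),
          (∀ a, σ a = 1 ∨ σ a = -1) →
          (∀ a b : Fin l, a ≠ b →
            beamOmega d gbar m β (j a) ≠ beamOmega d gbar m β (j b)) →
          (∑ a, (σ a : ℝ) * beamOmega d gbar m β (j a)) ≠ 0) := by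
  obtain ⟨γ₀, hγ₀, hD⟩ := hadm
  choose A hA a E hE hgood using
    fun r : ℕ => good (β₂ := β₂) (m := m) gbar hd hsym hpos hγ₀ hD hβ₁ hm r
  have hall := MeasureTheory.ae_all_iff.mpr hgood
  refine ⟨Set.Ioo β₁ β₂ ∩ {β | ¬ ∀ r : ℕ, ∃ N₀ : ℕ, 1 ≤ N₀ ∧ ∀ N : ℕ, N₀ ≤ N →
      β ∉ Bad d gbar m β₁ β₂ r ((A r * N ^ a r) ^ (-E r) / 2) N}, Set.inter_subset_left,
    MeasureTheory.measure_mono_null Set.inter_subset_right (MeasureTheory.ae_iff.mp hall), ?_⟩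
  intro β hβ hnot
  have hβ0 : 0 < β := hβ₁.trans hβ.1
  have hg : ∀ r : ℕ, ∃ N₀ : ℕ, 1 ≤ N₀ ∧ ∀ N : ℕ, N₀ ≤ N →
      β ∉ Bad d gbar m β₁ β₂ r ((A r * N ^ a r) ^ (-E r) / 2) N := by
    by_contra hcon
    exact hnot ⟨hβ, hcon⟩
  have hlow : ∀ (r : ℕ) (N₀ : ℕ), (∀ N : ℕ, N₀ ≤ N →
      β ∉ Bad d gbar m β₁ β₂ r ((A r * N ^ a r) ^ (-E r) / 2) N) → ∀ M : ℕ, N₀ ≤ M →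
      ∀ (j : Fin r → Zd d) (σ : Fin r → ℤ), (∀ l, σ l = 1 ∨ σ l = -1) →
      (∀ l, enorm (j l) ≤ (M : ℝ)) →
      (∃ v, (∑ l ∈ Finset.univ.filter (fun l => qform d gbar (j l) ^ 2 = v), σ l) ≠ 0) →
      (A r * M ^ a r) ^ (-E r) / 2 ≤ |∑ l, (σ l : ℝ) * beamOmega d gbar m β (j l)| := by
    intro r N₀ hN₀ M hM j σ hσ hj hnd
    by_contra hcon
    exact hN₀ M hM ⟨hβ, j, σ, hσ, hj, hnd, not_le.mp hcon⟩
  refine ⟨?_, ?_, ?_⟩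
  · intro r _
    obtain ⟨N₀, h1, hN₀⟩ := hg r
    have hA0 : 0 < A r := by linarith [hA r]
    have hN0R : (1 : ℝ) ≤ N₀ := by exact_mod_cast h1
    refine ⟨(A r * N₀ ^ a r) ^ (-E r) / 2, by positivity, a r * E r, ?_⟩
    intro N hN j σ hσ hj hne
    have hNR : (1 : ℝ) ≤ N := by exact_mod_cast hN
    have hM := hlow r N₀ hN₀ (N₀ * N) (Nat.le_mul_of_pos_right _ hN) j σ hσ
      (fun l => (hj l).trans (by push_cast; nlinarith)) (nondeg_of_ne gbar m β j σ hne)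
    refine le_trans (le_of_eq ?_) hM
    push_cast
    rw [mul_pow, ← mul_assoc, Real.mul_rpow (x := A r * (N₀ : ℝ) ^ a r) (by positivity) (by positivity),
      ← Real.rpow_natCast (N : ℝ) (a r), ← Real.rpow_mul (by positivity), mul_neg,
      Real.rpow_neg (by positivity) ((a r : ℝ) * E r)]
    ring
  · obtain ⟨C, hC, h⟩ := dyadic gbar hpos
    refine ⟨C, hC, fun i j k h1 h2 => h j k ?_⟩
    rw [omega_inj gbar hpos hm hβ0 h1, omega_inj gbar hpos hm hβ0 h2]
  · intro l hl j σ hσ hdist hzero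
    obtain ⟨N₀, h1, hN₀⟩ := hg l
    have hA0 : 0 < A l := by linarith [hA l]
    obtain ⟨M, hM⟩ := exists_nat_ge (∑ b, enorm (j b))
    have he : ∀ b, 0 ≤ enorm (j b) := fun b => Real.sqrt_nonneg _
    have hb := hlow l N₀ hN₀ (N₀ + M) (by omega) j σ hσ (by
      intro b
      have := Finset.single_le_sum (f := fun b => enorm (j b)) (fun b _ => he b)
        (Finset.mem_univ b)
      have h0 : (0 : ℝ) ≤ N₀ := by positivity
      push_cast
      linarith) (by
      refine ⟨qform d gbar (j ⟨0, hl⟩) ^ 2, ?_⟩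
      have hfil : Finset.univ.filter (fun b => qform d gbar (j b) ^ 2 =
          qform d gbar (j ⟨0, hl⟩) ^ 2) = {⟨0, hl⟩} := by
        ext b
        simp only [Finset.mem_filter, Finset.mem_univ, true_and, Finset.mem_singleton]
        constructor
        · intro h
          by_contra hne
          apply hdist b ⟨0, hl⟩ hne
          unfold beamOmega
          rw [h]
        · rintro rfl; rfl
      rw [hfil, Finset.sum_singleton]
      rcases hσ ⟨0, hl⟩ with h | h <;> rw [h] <;> norm_num)
    rw [hzero, abs_zero] at hb
    have hNp : (0 : ℝ) < ((N₀ + M : ℕ) : ℝ) := by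
      have : 0 < N₀ + M := by omega
      exact_mod_cast this
    have : 0 < (A l * ((N₀ + M : ℕ) : ℝ) ^ a l) ^ (-E l) / 2 := by positivity
    linarith

end AG
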